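/- Let φ : S → Σ be a homomorphism of inverse semigroups and let K = { s ∈ S : φ(s) ∈ E(Σ) }. Then K is a normal inverse subsemigroup of S, and for all s, t ∈ S, if s ≃_K t then φ(s) = φ(t). -/

import Mathlib

/-- An inverse semigroup: a semigroup in which every element `s` has a
(unique) inverse `s⁻¹` with `s * s⁻¹ * s = s` and `s⁻¹ * s * s⁻¹ = s⁻¹`. -/
class InverseSemigroup (S : Type*) extends Semigroup S, Inv S where
  mul_inv_mul : ∀ s : S, s * s⁻¹ * s = s
  inv_mul_inv : ∀ s : S, s⁻¹ * s * s⁻¹ = s⁻¹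
  inv_unique : ∀ s t : S, s * t * s = s → t * s * t = t → t = s⁻¹

/-- The natural partial order on an inverse semigroup:
`s ≤ t` iff `s = e * t` for some idempotent `e`. -/
def NatLe {S : Type*} [InverseSemigroup S] (s t : S) : Prop :=
  ∃ e : S, IsIdempotentElem e ∧ s = e * t

/-- A normal inverse subsemigroup: a full inverse subsemigroup that is
closed under conjugation. -/
structure IsNormalInverseSubsemigroup {S : Type*} [InverseSemigroup S] (N : Set S) : Prop where
  mul_mem : ∀ {a b : S}, a ∈ N → b ∈ N → a * b ∈ N
  inv_mem : ∀ {a : S}, a ∈ N → a⁻¹ ∈ N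
  full : ∀ {e : S}, IsIdempotentElem e → e ∈ N
  conj_mem : ∀ (s : S) {n : S}, n ∈ N → s⁻¹ * n * s ∈ N

/-- The preorder `≤_N` associated to a normal inverse subsemigroup `N`:
`s ≤_N t` iff there are `a, b ∈ N` with `a⁻¹ * a = s * s⁻¹`,
`s⁻¹ * s = b * b⁻¹` (so `a · s · b` is a trace product) and `a * s * b ≤ t`. -/
def LeN {S : Type*} [InverseSemigroup S] (N : Set S) (s t : S) : Prop :=
  ∃ a ∈ N, ∃ b ∈ N, a⁻¹ * a = s * s⁻¹ ∧ s⁻¹ * s = b * b⁻¹ ∧ NatLe (a * s * b) t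

/-- The equivalence `≃_N` obtained by symmetrizing `≤_N`. -/
def SimeqN {S : Type*} [InverseSemigroup S] (N : Set S) (s t : S) : Prop :=
  LeN N s t ∧ LeN N t s

namespace InverseSemigroup

variable {S T : Type*} [InverseSemigroup S] [InverseSemigroup T]

theorem isIdempotentElem_mul_inv (s : S) : IsIdempotentElem (s * s⁻¹) := by
  rw [IsIdempotentElem, ← mul_assoc, mul_inv_mul]

theorem inv_eq_self {e : S} (he : IsIdempotentElem e) : e⁻¹ = e :=
  (inv_unique e e (by rw [he.eq, he.eq]) (by rw [he.eq, he.eq])).symm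

theorem isIdempotentElem_mul {e f : S} (he : IsIdempotentElem e) (hf : IsIdempotentElem f) :
    IsIdempotentElem (e * f) := by
  have hee (z : S) : e * (e * z) = e * z := by rw [← mul_assoc, he.eq]
  have hff (z : S) : f * (f * z) = f * z := by rw [← mul_assoc, hf.eq]
  have h₁ := mul_inv_mul (e * f)
  have h₂ := inv_mul_inv (e * f)
  have h₃ := inv_unique (e * f) (f * (e * f)⁻¹ * e)
  generalize (e * f)⁻¹ = x at h₁ h₂ h₃
  have h₂' (z : S) : x * (e * (f * (x * z))) = x * z := by
    simpa only [mul_assoc] using congrArg (· * z) h₂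
  simp only [mul_assoc] at h₁ h₂ h₃
  have hx : f * (x * e) = x := h₃ (by rw [hff, hee, h₁]) (by rw [hee, hff, h₂'])
  have hxx : IsIdempotentElem x := by
    rw [IsIdempotentElem, ← hx]
    simp only [mul_assoc]
    rw [h₂']
  have h : e * f = x := by
    rw [inv_unique x (e * f) (by simpa only [mul_assoc] using h₂)
      (by simpa only [mul_assoc] using h₁), inv_eq_self hxx]
  rwa [h]

theorem mul_comm_of_isIdempotentElem {e f : S} (he : IsIdempotentElem e)
    (hf : IsIdempotentElem f) : e * f = f * e := by
  have hee (z : S) : e * (e * z) = e * z := by rw [← mul_assoc, he.eq]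
  have hff (z : S) : f * (f * z) = f * z := by rw [← mul_assoc, hf.eq]
  have hef := isIdempotentElem_mul he hf
  have hfe := isIdempotentElem_mul hf he
  rw [inv_unique (e * f) (f * e), inv_eq_self hef]
  · simpa only [mul_assoc, hee, hff] using hef.eq
  · simpa only [mul_assoc, hee, hff] using hfe.eq

theorem isIdempotentElem_conj (s : S) {e : S} (he : IsIdempotentElem e) :
    IsIdempotentElem (s⁻¹ * e * s) := by
  calc s⁻¹ * e * s * (s⁻¹ * e * s) = s⁻¹ * (e * (s * s⁻¹)) * e * s := by simp only [mul_assoc]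
    _ = s⁻¹ * s * s⁻¹ * (e * e) * s := by
      rw [mul_comm_of_isIdempotentElem he (isIdempotentElem_mul_inv s)]
      simp only [mul_assoc]
    _ = s⁻¹ * e * s := by rw [inv_mul_inv, he.eq]

theorem map_inv_of_map_mul {φ : S → T} (hφ : ∀ a b : S, φ (a * b) = φ a * φ b) (s : S) :
    φ s⁻¹ = (φ s)⁻¹ :=
  inv_unique _ _ (by rw [← hφ, ← hφ, mul_inv_mul]) (by rw [← hφ, ← hφ, inv_mul_inv])

theorem isIdempotentElem_map {φ : S → T} (hφ : ∀ a b : S, φ (a * b) = φ a * φ b) {e : S}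
    (he : IsIdempotentElem e) : IsIdempotentElem (φ e) := by
  rw [IsIdempotentElem, ← hφ, he.eq]

end InverseSemigroup

open InverseSemigroup

theorem NatLe.antisymm {S : Type*} [InverseSemigroup S] {s t : S} (hst : NatLe s t)
    (hts : NatLe t s) : s = t := by
  obtain ⟨e, he, hs⟩ := hst
  obtain ⟨f, hf, ht⟩ := hts
  have hes : e * s = s := by rw [hs, ← mul_assoc, he.eq]
  calc s = e * (f * s) := by rw [← ht, ← hs]
    _ = f * (e * s) := by
      rw [← mul_assoc, mul_comm_of_isIdempotentElem he hf, mul_assoc]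
    _ = t := by rw [hes, ← ht]

theorem LeN.natLe_map {S T : Type*} [InverseSemigroup S] [InverseSemigroup T] {φ : S → T}
    (hφ : ∀ a b : S, φ (a * b) = φ a * φ b) {s t : S}
    (h : LeN {s : S | IsIdempotentElem (φ s)} s t) : NatLe (φ s) (φ t) := by
  obtain ⟨a, ha, b, hb, has, hsb, e, he, hle⟩ := h
  rw [Set.mem_ofPred_eq] at ha hb
  have hφa : φ a = φ s * (φ s)⁻¹ := by
    rw [← map_inv_of_map_mul hφ, ← hφ, ← has, hφ, map_inv_of_map_mul hφ, inv_eq_self ha, ha.eq]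
  have hφb : φ b = (φ s)⁻¹ * φ s := by
    rw [← map_inv_of_map_mul hφ, ← hφ, hsb, hφ, map_inv_of_map_mul hφ, inv_eq_self hb, hb.eq]
  refine ⟨φ e, isIdempotentElem_map hφ he, ?_⟩
  rw [← hφ, ← hle, hφ, hφ, hφa, hφb, mul_inv_mul, ← mul_assoc, mul_inv_mul]

/-- The kernel `K` of a homomorphism of inverse semigroups is a normal inverse
subsemigroup, and `s ≃_K t` implies `φ s = φ t` (so `φ` factors through the
quotient `S // K`). -/
theorem kernel_normal_and_hom_factors {S T : Type*} [InverseSemigroup S] [InverseSemigroup T]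
    (φ : S → T) (hφ : ∀ a b : S, φ (a * b) = φ a * φ b) :
    IsNormalInverseSubsemigroup {s : S | IsIdempotentElem (φ s)} ∧
    ∀ s t : S, SimeqN {s : S | IsIdempotentElem (φ s)} s t → φ s = φ t := by
  refine ⟨⟨fun {a b} ha hb => ?_, fun {a} ha => ?_, isIdempotentElem_map hφ, fun s n hn => ?_⟩,
    fun s t h => (h.1.natLe_map hφ).antisymm (h.2.natLe_map hφ)⟩
  · rw [Set.mem_ofPred_eq, hφ]
    exact isIdempotentElem_mul ha hb
  · rw [Set.mem_ofPred_eq, map_inv_of_map_mul hφ, inv_eq_self ha]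
    exact ha
  · rw [Set.mem_ofPred_eq, hφ, hφ, map_inv_of_map_mul hφ]
    exact isIdempotentElem_conj (φ s) hn
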